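/- arXiv:1904.12600 — 6 statements merged into one kernel-verified Lean document; each statement's English description precedes it below -/
import Mathlib

section
/- Let n ≥ 1 and 1 ≤ r ≤ n. Then the probability that the r-th smallest of the n values is the best (i.e., closest to 1/2 among all n values) equals C(n-1, r-1) / 2^(n-1). -/
open MeasureTheory

/-- The uniform probability measure on the cube `[0,1]^n`
(Lebesgue product measure of `volume` restricted to `[0,1]` in each coordinate). -/
noncomputable def unifCube (n : ℕ) : Measure (Fin n → ℝ) :=
  Measure.pi fun _ => volume.restrict (Set.Icc 0 1)

/-- The `r`-th smallest value (`0`-indexed) among the coordinates of `x`. -/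
noncomputable def orderStat {n : ℕ} (x : Fin n → ℝ) (r : Fin n) : ℝ :=
  x (Tuple.sort x r)

open Finset in
/-- For an injective tuple, exactly `r` entries are smaller than the `r`-th order statistic. -/
lemma card_lt_orderStat {n : ℕ} {x : Fin n → ℝ} (hx : Function.Injective x) (r : Fin n) :
    #{i | x i < orderStat x r} = (r : ℕ) := by
  have hmono : StrictMono (x ∘ Tuple.sort x) :=
    (Tuple.monotone_sort x).strictMono_of_injective (hx.comp (Tuple.sort x).injective)
  have hset : ({i | x i < orderStat x r} : Finset (Fin n)) =
      (Iio r).map (Tuple.sort x).toEmbedding := by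
    ext i
    obtain ⟨j, rfl⟩ := (Tuple.sort x).surjective i
    rw [mem_filter_univ]
    simpa [orderStat] using hmono.lt_iff_lt (a := j) (b := r)
  rw [hset, card_map, Fin.card_Iio]

/-- The reflection `t ↦ 1 - t` applied to the coordinates in `T`. -/
def reflectCoords {n : ℕ} (T : Finset (Fin n)) (x : Fin n → ℝ) (i : Fin n) : ℝ :=
  if i ∈ T then 1 - x i else x i

lemma abs_reflectCoords_sub_half {n : ℕ} (T : Finset (Fin n)) (x : Fin n → ℝ) (i : Fin n) :
    |reflectCoords T x i - 1/2| = |x i - 1/2| := by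
  unfold reflectCoords
  split_ifs
  · rw [show 1 - x i - 1/2 = -(x i - 1/2) by ring, abs_neg]
  · rfl

lemma measurePreserving_one_sub_restrict_Icc :
    MeasurePreserving (fun t : ℝ => 1 - t) (volume.restrict (Set.Icc 0 1))
      (volume.restrict (Set.Icc 0 1)) := by
  have h := (Measure.measurePreserving_sub_left (volume : Measure ℝ) 1).restrict_preimage
    (measurableSet_Icc (a := (0 : ℝ)) (b := 1))
  simpa using h

lemma measurePreserving_reflectCoords {n : ℕ} (T : Finset (Fin n)) :
    MeasurePreserving (reflectCoords T) (unifCube n) (unifCube n) := by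
  refine measurePreserving_pi (f := fun i t => if i ∈ T then 1 - t else t) _ _ fun i => ?_
  by_cases hi : i ∈ T
  · simpa [hi] using measurePreserving_one_sub_restrict_Icc
  · simp only [hi, if_false]
    exact MeasurePreserving.id _

instance isProbabilityMeasure_unifCube (n : ℕ) : IsProbabilityMeasure (unifCube n) := by
  have : IsProbabilityMeasure (volume.restrict (Set.Icc (0 : ℝ) 1)) := ⟨by simp⟩
  unfold unifCube
  infer_instance

/-- The hyperplane `x i + c * x j = d`. -/
def twoCoordHyperplane {n : ℕ} (i j : Fin n) (c d : ℝ) : AffineSubspace ℝ (Fin n → ℝ) where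
  carrier := {x | x i + c * x j = d}
  smul_vsub_vadd_mem' a x y z hx hy hz := by
    simp only [Set.mem_ofPred_eq, vsub_eq_sub, vadd_eq_add, Pi.add_apply, Pi.smul_apply,
      Pi.sub_apply, smul_eq_mul] at *
    linear_combination a * hx - a * hy + hz

lemma ae_add_mul_ne {n : ℕ} {i j : Fin n} (hij : i ≠ j) (c d : ℝ) :
    ∀ᵐ x ∂unifCube n, x i + c * x j ≠ d := by
  have hac : unifCube n ≪ volume := by
    unfold unifCube
    rw [← Measure.restrict_pi_pi]
    exact Measure.absolutelyContinuous_of_le Measure.restrict_le_self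
  refine hac.ae_le (ae_iff.mpr ?_)
  have hne : twoCoordHyperplane i j c d ≠ ⊤ := by
    intro htop
    have hmem : (Pi.single i (d + 1) : Fin n → ℝ) ∈ twoCoordHyperplane i j c d := by
      rw [htop]; trivial
    change (Pi.single i (d + 1) : Fin n → ℝ) i + c * (Pi.single i (d + 1) : Fin n → ℝ) j = d
      at hmem
    simp [Pi.single_eq_of_ne hij.symm] at hmem
  simp only [ne_eq, not_not]
  exact Measure.addHaar_affineSubspace volume _ hne

/-- Almost surely the distances to `1/2` are pairwise distinct. -/
lemma ae_injective_abs_sub_half (n : ℕ) :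
    ∀ᵐ x ∂unifCube n, Function.Injective fun i => |x i - 1/2| := by
  have h : ∀ᵐ x ∂unifCube n, ∀ i j, i ≠ j → x i + (-1) * x j ≠ 0 ∧ x i + 1 * x j ≠ 1 := by
    simp only [ae_all_iff]
    exact fun i j hij => (ae_add_mul_ne hij _ _).and (ae_add_mul_ne hij _ _)
  filter_upwards [h] with x hx i j hij
  by_contra hne
  rcases abs_eq_abs.mp hij with h | h
  · exact (hx i j hne).1 (by linarith)
  · exact (hx i j hne).2 (by linarith)

open Finset in
/-- Some coordinate is closest to `1/2` and has exactly `s` smaller coordinates. -/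
def bestHasCardBelow (n s : ℕ) : Set (Fin n → ℝ) :=
  {x | ∃ k, (∀ i, |x k - 1/2| ≤ |x i - 1/2|) ∧ #{i | x i < x k} = s}

open Finset in
lemma measurableSet_bestHasCardBelow (n s : ℕ) : MeasurableSet (bestHasCardBelow n s) := by
  have hset : bestHasCardBelow n s = ⋃ k, ((⋂ i, {x | |x k - 1/2| ≤ |x i - 1/2|}) ∩
      (fun x : Fin n → ℝ => ∑ i, if x i < x k then 1 else 0) ⁻¹' {s}) := by
    ext x
    simp [bestHasCardBelow]
  rw [hset]
  refine .iUnion fun k => .inter (.iInter fun i => ?_) ?_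
  · exact measurableSet_le (by fun_prop) (by fun_prop)
  · refine measurableSet_preimage ?_ (measurableSet_singleton s)
    exact Finset.measurable_sum _ fun i _ => Measurable.ite
      (measurableSet_lt (by fun_prop) (by fun_prop)) measurable_const measurable_const

lemma orderStat_isBest_iff {n : ℕ} {x : Fin n → ℝ} (hx : Function.Injective x) (r : Fin n) :
    (∀ i, |orderStat x r - 1/2| ≤ |x i - 1/2|) ↔ x ∈ bestHasCardBelow n r := by
  refine ⟨fun h => ⟨_, h, card_lt_orderStat hx r⟩, ?_⟩
  rintro ⟨k, hk, hcard⟩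
  obtain ⟨j, rfl⟩ := (Tuple.sort x).surjective k
  have hjr : j = r := Fin.ext ((card_lt_orderStat hx j).symm.trans hcard)
  exact hjr ▸ hk

open Finset in
lemma card_filter_card_erase_eq {α : Type*} [Fintype α] [DecidableEq α] (k : α) (s : ℕ) :
    #{U : Finset α | #(U.erase k) = s} = 2 * (Fintype.card α - 1).choose s := by
  have hk : k ∉ univ.erase k := notMem_erase k univ
  have hbelow : #{U ∈ (univ.erase k).powerset | #U = s} = (Fintype.card α - 1).choose s := by
    rw [← powersetCard_eq_filter, card_powersetCard, card_erase_of_mem (mem_univ k), card_univ]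
  rw [← powerset_univ, ← insert_erase (mem_univ k), card_filter, sum_powerset_insert hk, two_mul,
    ← hbelow, card_filter]
  have hnot : ∀ U ∈ (univ.erase k).powerset, k ∉ U := fun U hU hkU => hk (mem_powerset.mp hU hkU)
  congr 1 <;> refine sum_congr rfl fun U hU => ?_
  · rw [erase_eq_of_notMem (hnot U hU)]
  · rw [erase_insert (hnot U hU)]

open Finset symmDiff in
lemma card_reflectCoords_mem_bestHasCardBelow {n : ℕ} (hn : 1 ≤ n) (s : ℕ) {x : Fin n → ℝ}
    (hx : Function.Injective fun i => |x i - 1/2|) [DecidablePred (· ∈ bestHasCardBelow n s)] :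
    #{T : Finset (Fin n) | reflectCoords T x ∈ bestHasCardBelow n s} =
      2 * (n - 1).choose s := by
  have : Nonempty (Fin n) := ⟨⟨0, hn⟩⟩
  obtain ⟨k, hk⟩ := Finite.exists_min fun i => |x i - 1/2|
  have hlt : ∀ i, i ≠ k → |x k - 1/2| < |x i - 1/2| := fun i hi =>
    (hk i).lt_of_ne fun h => hi (hx h).symm
  set L : Finset (Fin n) := {i | x i < 1/2}
  have hbelow : ∀ T : Finset (Fin n),
      ({i | reflectCoords T x i < reflectCoords T x k} : Finset (Fin n)) = (L ∆ T).erase k := by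
    intro T
    ext i
    rcases eq_or_ne i k with rfl | hi
    · simp
    have h := hlt i hi
    rw [← abs_reflectCoords_sub_half T x k] at h
    have hk1 := abs_lt.mp h
    simp only [mem_filter, mem_univ, true_and, mem_erase, mem_symmDiff, L, ne_eq, hi,
      not_false_eq_true]
    by_cases hT : i ∈ T
    · simp only [reflectCoords, hT, if_true, not_true, and_false, not_lt, true_and, false_or]
      rcases abs_cases (x i - 1/2) with ⟨ha, hb⟩ | ⟨ha, hb⟩ <;> rw [ha] at hk1 <;>
        simp only [reflectCoords] at hk1 <;> constructor <;> intro <;> linarith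
    · simp only [reflectCoords, hT, if_false, not_false_eq_true, and_true, false_and, or_false]
      rcases abs_cases (x i - 1/2) with ⟨ha, hb⟩ | ⟨ha, hb⟩ <;> rw [ha] at hk1 <;>
        simp only [reflectCoords] at hk1 <;> constructor <;> intro <;> linarith
  have hmem : ∀ T : Finset (Fin n),
      reflectCoords T x ∈ bestHasCardBelow n s ↔ #((L ∆ T).erase k) = s := by
    intro T
    simp only [bestHasCardBelow, Set.mem_ofPred_eq, abs_reflectCoords_sub_half]
    constructor
    · rintro ⟨j, hj, hcard⟩
      obtain rfl : j = k := by
        by_contra hjk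
        exact (hlt j hjk).not_ge (hj k)
      rwa [hbelow] at hcard
    · exact fun h => ⟨k, hk, by rwa [hbelow]⟩
  simp only [hmem]
  have hcount := card_filter_card_erase_eq k s
  rw [Fintype.card_fin] at hcount
  rw [← hcount]
  exact card_bij' (fun T _ => L ∆ T) (fun U _ => L ∆ U) (by simp) (by simp) (by simp) (by simp)

lemma unifCube_bestHasCardBelow {n : ℕ} (hn : 1 ≤ n) (s : ℕ) :
    unifCube n (bestHasCardBelow n s) = ((n - 1).choose s : ENNReal) / 2 ^ (n - 1) := by
  classical
  set G := bestHasCardBelow n s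
  have hG : MeasurableSet G := measurableSet_bestHasCardBelow n s
  have hsum : (2 : ENNReal) ^ n * unifCube n G = 2 * ((n - 1).choose s : ENNReal) := by
    calc (2 : ENNReal) ^ n * unifCube n G
        = ∑ T : Finset (Fin n), unifCube n (reflectCoords T ⁻¹' G) := by
          simp [(measurePreserving_reflectCoords _).measure_preimage hG.nullMeasurableSet]
      _ = ∫⁻ x, ∑ T : Finset (Fin n), (reflectCoords T ⁻¹' G).indicator 1 x ∂unifCube n := by
          have hmeas : ∀ T : Finset (Fin n), MeasurableSet (reflectCoords T ⁻¹' G) := fun T =>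
            (measurePreserving_reflectCoords T).measurable hG
          rw [lintegral_finsetSum _ fun T _ => measurable_one.indicator (hmeas T)]
          simp only [lintegral_indicator_one (hmeas _)]
      _ = ∫⁻ _, 2 * ((n - 1).choose s : ENNReal) ∂unifCube n := by
          refine lintegral_congr_ae ?_
          filter_upwards [ae_injective_abs_sub_half n] with x hx
          have h := card_reflectCoords_mem_bestHasCardBelow hn s hx
          simp only [Set.indicator_apply, Set.mem_preimage, Pi.one_apply, Finset.sum_boole]
          rw [h]
          push_cast
          rfl
      _ = 2 * ((n - 1).choose s : ENNReal) := by simp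
  obtain ⟨m, rfl⟩ : ∃ m, n = m + 1 := ⟨n - 1, by omega⟩
  rw [pow_succ', mul_assoc, ENNReal.mul_right_inj (by simp) (by simp)] at hsum
  rw [ENNReal.eq_div_iff (by simp) (by simp)]
  exact hsum

/-- The probability that the `r`-th smallest of `n` i.i.d. uniform values on `[0,1]`
is closest to `1/2` among all of them equals `C(n-1, r-1) / 2^(n-1)`. -/
theorem best_prob_of_rank (n r : ℕ) (hn : 1 ≤ n) (hr1 : 1 ≤ r) (hrn : r ≤ n) :
    unifCube n {x | ∀ i, |orderStat x ⟨r - 1, by omega⟩ - 1/2| ≤ |x i - 1/2|} =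
      ENNReal.ofReal (((n - 1).choose (r - 1) : ℝ) / 2 ^ (n - 1)) := by
  rw [ENNReal.ofReal_div_of_pos (by positivity), ENNReal.ofReal_natCast,
    ENNReal.ofReal_pow (by norm_num), ENNReal.ofReal_ofNat, ← unifCube_bestHasCardBelow hn]
  refine measure_congr ?_
  filter_upwards [ae_injective_abs_sub_half n] with x hx
  have hinj : Function.Injective x := fun i j hij => hx (by simp only [hij])
  exact propext (orderStat_isBest_iff hinj _)
end

section
/- Let n ≥ 1 and 1 ≤ r ≤ n−1. Then the probability of the event { y_r < 1/2 < y_{r+1} and |y_r − 1/2| ≤ |y_{r+1} − 1/2| } equals C(n,r) · (1/2^n) · (r/n). -/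
open MeasureTheory

/-- The configurations in which the coordinates indexed by `S` lie below `1/2`, the largest of them
(ties being broken by the index) is the one at `i`, and the remaining coordinates are at least as
far from `1/2` as the one at `i`. -/
def straddleCell {n : ℕ} (S : Finset (Fin n)) (i : Fin n) : Set (Fin n → ℝ) :=
  {x | x i < 1 / 2 ∧ ∀ j ≠ i,
    (j ∈ S → x j ≤ x i ∧ (i < j → x j < x i)) ∧ (j ∉ S → 1 - x i ≤ x j)}

/-- The indices of the `r` smallest coordinates of `x`. -/
noncomputable def lowIndices {n : ℕ} (x : Fin n → ℝ) (r : ℕ) : Finset (Fin n) :=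
  (Finset.univ.filter fun k : Fin n => k.val < r).map (Tuple.sort x).toEmbedding

lemma apply_sort_mem_lowIndices {n r : ℕ} {x : Fin n → ℝ} {k : Fin n} :
    Tuple.sort x k ∈ lowIndices x r ↔ k.val < r := by
  simp [lowIndices]

lemma card_lowIndices {n r : ℕ} (x : Fin n → ℝ) (hr : r ≤ n) : (lowIndices x r).card = r := by
  simp [lowIndices, Fin.card_filter_val_lt, hr]

lemma sort_stable {n : ℕ} (x : Fin n → ℝ) {k l : Fin n} (hkl : k < l)
    (h : x (Tuple.sort x k) = x (Tuple.sort x l)) : Tuple.sort x k < Tuple.sort x l :=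
  (Tuple.eq_sort_iff.1 rfl).2 k l hkl h

lemma orderStat_mono {n : ℕ} (x : Fin n → ℝ) : Monotone (orderStat x) :=
  Tuple.monotone_sort x

lemma eq_lowIndices_of_lt {n r : ℕ} {x : Fin n → ℝ} {S : Finset (Fin n)} (hS : S.card = r)
    (hr : r ≤ n) (h : ∀ j ∈ S, ∀ k ∉ S, x j < x k) : S = lowIndices x r := by
  by_contra hne
  have hc : (lowIndices x r).card = S.card := by rw [card_lowIndices x hr, hS]
  have h1 : ¬ S ⊆ lowIndices x r := fun hs => hne (Finset.eq_of_subset_of_card_le hs hc.le)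
  have h2 : ¬ lowIndices x r ⊆ S := fun hs => hne (Finset.eq_of_subset_of_card_le hs hc.ge).symm
  obtain ⟨j, hjS, hj⟩ := Finset.not_subset.1 h1
  obtain ⟨k, hk, hkS⟩ := Finset.not_subset.1 h2
  obtain ⟨a, rfl⟩ := (Tuple.sort x).surjective j
  obtain ⟨b, rfl⟩ := (Tuple.sort x).surjective k
  rw [apply_sort_mem_lowIndices] at hj hk
  have hba : b ≤ a := by rw [Fin.le_def]; omega
  exact absurd (Tuple.monotone_sort x hba) (not_le.2 (h _ hjS _ hkS))

lemma mem_straddleCell_iff {n : ℕ} {p q : Fin n} (hpq : q.val = p.val + 1)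
    {S : Finset (Fin n)} (hS : S.card = q.val) {i : Fin n} (hi : i ∈ S) (x : Fin n → ℝ) :
    x ∈ straddleCell S i ↔ (orderStat x p < 1 / 2 ∧ 1 - orderStat x p ≤ orderStat x q) ∧
      S = lowIndices x q ∧ i = Tuple.sort x p := by
  constructor
  · rintro ⟨hx, h⟩
    have hle : ∀ j ∈ S, x j ≤ x i := fun j hj => by
      rcases eq_or_ne j i with rfl | hne
      · exact le_rfl
      · exact ((h j hne).1 hj).1
    have hge : ∀ j ∉ S, 1 - x i ≤ x j := fun j hj =>
      (h j (fun e => hj (e ▸ hi))).2 hj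
    have hlow : S = lowIndices x q := eq_lowIndices_of_lt hS q.isLt.le fun j hj k hk => by
      linarith [hle j hj, hge k hk]
    have hpS : Tuple.sort x p ∈ S := by rw [hlow, apply_sort_mem_lowIndices]; omega
    have hqS : Tuple.sort x q ∉ S := by rw [hlow, apply_sort_mem_lowIndices]; omega
    have hip : i = Tuple.sort x p := by
      obtain ⟨k, rfl⟩ := (Tuple.sort x).surjective i
      by_contra hne
      have hkq : k.val < q := by rwa [hlow, apply_sort_mem_lowIndices] at hi
      have hkp : k < p := by
        have : k ≠ p := fun e => hne (e ▸ rfl)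
        rw [Fin.lt_def]
        have := Fin.val_ne_of_ne this
        omega
      have heq := le_antisymm (Tuple.monotone_sort x hkp.le) (hle _ hpS)
      exact (((h _ (Ne.symm hne)).1 hpS).2 (sort_stable x hkp heq)).ne heq.symm
    refine ⟨⟨?_, ?_⟩, hlow, hip⟩
    · rw [hip] at hx; exact hx
    · have := hge _ hqS
      rw [hip] at this; exact this
  · rintro ⟨⟨h1, h2⟩, rfl, rfl⟩
    refine ⟨h1, fun j hj => ?_⟩
    obtain ⟨k, rfl⟩ := (Tuple.sort x).surjective j
    rw [apply_sort_mem_lowIndices]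
    have hkp : k ≠ p := fun e => hj (e ▸ rfl)
    have := Fin.val_ne_of_ne hkp
    refine ⟨fun hk => ?_, fun hk => ?_⟩
    · have hlt : k < p := by rw [Fin.lt_def]; omega
      have hle : x (Tuple.sort x k) ≤ x (Tuple.sort x p) := Tuple.monotone_sort x hlt.le
      exact ⟨hle, fun hij => hle.lt_of_ne fun e => (sort_stable x hlt e).not_gt hij⟩
    · have hqk : q ≤ k := by rw [Fin.le_def]; omega
      exact h2.trans (orderStat_mono x hqk)

/-- The values allowed for the coordinate at `j` in `straddleCell S i` when the one at `i` is `u`. -/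
def cellSlice {n : ℕ} (S : Finset (Fin n)) (i j : Fin n) (u : ℝ) : Set ℝ :=
  {t | (j ∈ S → t ≤ u ∧ (i < j → t < u)) ∧ (j ∉ S → 1 - u ≤ t)}

lemma volume_cellSlice {n : ℕ} (S : Finset (Fin n)) (i j : Fin n) {u : ℝ} (h1 : u ≤ 1) :
    volume.restrict (Set.Icc (0 : ℝ) 1) (cellSlice S i j u) = ENNReal.ofReal u := by
  rw [Measure.restrict_apply' measurableSet_Icc]
  by_cases hj : j ∈ S
  · by_cases hij : i < j
    · have : cellSlice S i j u ∩ Set.Icc 0 1 = Set.Ico 0 u := by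
        ext t
        simp only [cellSlice, hj, hij, Set.mem_inter_iff, Set.mem_ofPred_eq, Set.mem_Icc,
          Set.mem_Ico, forall_const, not_true_eq_false, IsEmpty.forall_iff, and_true]
        exact ⟨fun h => ⟨h.2.1, h.1.2⟩, fun h => ⟨⟨h.2.le, h.2⟩, h.1, h.2.le.trans h1⟩⟩
      simp [this]
    · have : cellSlice S i j u ∩ Set.Icc 0 1 = Set.Icc 0 u := by
        ext t
        simp only [cellSlice, hj, hij, Set.mem_inter_iff, Set.mem_ofPred_eq, Set.mem_Icc,
          forall_const, not_true_eq_false, IsEmpty.forall_iff, and_true]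
        exact ⟨fun h => ⟨h.2.1, h.1⟩, fun h => ⟨h.2, h.1, h.2.trans h1⟩⟩
      simp [this]
  · have : cellSlice S i j u ∩ Set.Icc 0 1 = Set.Icc (1 - u) 1 := by
      ext t
      simp only [cellSlice, hj, Set.mem_inter_iff, Set.mem_ofPred_eq, Set.mem_Icc,
        forall_const, not_false_eq_true, IsEmpty.forall_iff, true_and]
      exact ⟨fun h => ⟨h.1, h.2.2⟩, fun h => ⟨h.1, by linarith, h.2⟩⟩
    simp [this]

lemma measurableSet_straddleCell {n : ℕ} (S : Finset (Fin n)) (i : Fin n) :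
    MeasurableSet (straddleCell S i) := by
  unfold straddleCell
  measurability

lemma lintegral_pow_unit_half (m : ℕ) :
    ∫⁻ u in Set.Ico (0 : ℝ) (1 / 2), ENNReal.ofReal u ^ m =
      ENNReal.ofReal ((1 / 2) ^ (m + 1) / (m + 1)) := by
  have h : ∀ u ∈ Set.Ico (0 : ℝ) (1 / 2), ENNReal.ofReal u ^ m = ENNReal.ofReal (u ^ m) :=
    fun u hu => (ENNReal.ofReal_pow hu.1 m).symm
  rw [setLIntegral_congr_fun measurableSet_Ico h, setLIntegral_congr Ico_ae_eq_Ioc,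
    ← ofReal_integral_eq_lintegral_ofReal, ← intervalIntegral.integral_of_le (by norm_num),
    integral_pow]
  · simp
  · exact (intervalIntegrable_iff_integrableOn_Ioc_of_le (by norm_num)).1
      (intervalIntegral.intervalIntegrable_pow m)
  · filter_upwards [ae_restrict_mem measurableSet_Ioc] with u hu using pow_nonneg hu.1.le m

lemma unifCube_straddleCell {m : ℕ} (S : Finset (Fin (m + 1))) (i : Fin (m + 1)) :
    unifCube (m + 1) (straddleCell S i) = ENNReal.ofReal ((1 / 2) ^ (m + 1) / (m + 1)) := by
  have hmp := (measurePreserving_piFinSuccAbove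
    (fun _ : Fin (m + 1) => volume.restrict (Set.Icc (0 : ℝ) 1)) i).symm
  have hslice (u : ℝ) : Prod.mk u ⁻¹'
      ((MeasurableEquiv.piFinSuccAbove (fun _ => ℝ) i).symm ⁻¹' straddleCell S i) =
      if u < 1 / 2 then Set.univ.pi fun k => cellSlice S i (i.succAbove k) u else ∅ := by
    ext y
    have hiff : y ∈ Prod.mk u ⁻¹'
        ((MeasurableEquiv.piFinSuccAbove (fun _ => ℝ) i).symm ⁻¹' straddleCell S i) ↔
        i.insertNth (α := fun _ => ℝ) u y ∈ straddleCell S i := Iff.rfl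
    rw [hiff]
    simp only [straddleCell, Set.mem_ofPred_eq, Fin.forall_iff_succAbove i,
      Fin.insertNth_apply_same, Fin.insertNth_apply_succAbove]
    split_ifs with hu
    · simp only [hu, true_and]
      simp [cellSlice, Fin.succAbove_ne]
    · simp only [hu, false_and, Set.mem_empty_iff_false]
  rw [unifCube, ← hmp.measure_preimage (measurableSet_straddleCell S i).nullMeasurableSet,
    Measure.prod_apply (hmp.measurable (measurableSet_straddleCell S i)),
    ← lintegral_pow_unit_half m]
  have hval (u : ℝ) (hu : u ∈ Set.Icc (0 : ℝ) 1) :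
      Measure.pi (fun _ : Fin m => volume.restrict (Set.Icc (0 : ℝ) 1))
        (if u < 1 / 2 then Set.univ.pi fun k => cellSlice S i (i.succAbove k) u else ∅) =
      (Set.Iio (1 / 2)).indicator (fun u => ENNReal.ofReal u ^ m) u := by
    by_cases h : u < 1 / 2
    · simp only [h, if_true, Measure.pi_pi, volume_cellSlice S i _ hu.2]
      rw [Set.indicator_of_mem (Set.mem_Iio.2 h)]
      simp
    · rw [if_neg h, Set.indicator_of_notMem (by simpa only [Set.mem_Iio] using h), measure_empty]
  simp only [hslice]
  have hset : Set.Iio (1 / 2) ∩ Set.Icc (0 : ℝ) 1 = Set.Ico 0 (1 / 2) := by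
    ext u
    simp only [Set.mem_inter_iff, Set.mem_Iio, Set.mem_Icc, Set.mem_Ico]
    exact ⟨fun h => ⟨h.2.1, h.1⟩, fun h => ⟨h.2, h.1, by linarith [h.2]⟩⟩
  rw [setLIntegral_congr_fun measurableSet_Icc hval, lintegral_indicator measurableSet_Iio,
    Measure.restrict_restrict measurableSet_Iio, hset]

lemma straddle_eq_biUnion {n : ℕ} {p q : Fin n} (hpq : q.val = p.val + 1) :
    {x : Fin n → ℝ | orderStat x p < 1 / 2 ∧ 1 - orderStat x p ≤ orderStat x q} =
      ⋃ a ∈ (Finset.univ.powersetCard q.val).sigma (fun S : Finset (Fin n) => S),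
        straddleCell a.1 a.2 := by
  ext x
  simp only [Set.mem_iUnion, Finset.mem_sigma, Finset.mem_powersetCard, exists_prop, Sigma.exists,
    Set.mem_ofPred_eq]
  constructor
  · intro hx
    have hc := card_lowIndices x q.isLt.le
    have hp : Tuple.sort x p ∈ lowIndices x q := apply_sort_mem_lowIndices.2 (by omega)
    exact ⟨_, _, ⟨⟨Finset.subset_univ _, hc⟩, hp⟩,
      (mem_straddleCell_iff hpq hc hp x).2 ⟨hx, rfl, rfl⟩⟩
  · rintro ⟨S, i, ⟨⟨-, hS⟩, hi⟩, hx⟩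
    exact ((mem_straddleCell_iff hpq hS hi x).1 hx).1

lemma pairwiseDisjoint_straddleCell {n : ℕ} {p q : Fin n} (hpq : q.val = p.val + 1) :
    Set.PairwiseDisjoint
      ((Finset.univ.powersetCard q.val).sigma (fun S : Finset (Fin n) => S) :
        Set (Σ _ : Finset (Fin n), Fin n))
      (fun a => straddleCell a.1 a.2) := by
  rintro ⟨S, i⟩ ha ⟨T, j⟩ hb hne
  simp only [Finset.mem_coe, Finset.mem_sigma, Finset.mem_powersetCard] at ha hb
  refine Set.disjoint_left.2 fun x hx hy => hne ?_
  obtain ⟨-, rfl, rfl⟩ := (mem_straddleCell_iff hpq ha.1.2 ha.2 x).1 hx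
  obtain ⟨-, rfl, rfl⟩ := (mem_straddleCell_iff hpq hb.1.2 hb.2 x).1 hy
  rfl

lemma straddle_iff {a b : ℝ} :
    (a < 1 / 2 ∧ 1 / 2 < b ∧ |a - 1 / 2| ≤ |b - 1 / 2|) ↔ a < 1 / 2 ∧ 1 - a ≤ b := by
  constructor
  · rintro ⟨ha, hb, h⟩
    rw [abs_of_neg (by linarith), abs_of_pos (by linarith)] at h
    exact ⟨ha, by linarith⟩
  · rintro ⟨ha, h⟩
    refine ⟨ha, by linarith, ?_⟩
    rw [abs_of_neg (by linarith), abs_of_pos (by linarith)]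
    linarith

/-- For `n` i.i.d. uniform values on `[0,1]` with order statistics `y_1 < … < y_n`
(here `0`-indexed), the probability of the event
`{ y_r < 1/2 < y_{r+1}  and  |y_r - 1/2| ≤ |y_{r+1} - 1/2| }`
equals `C(n, r) · (1/2^n) · (r/n)`. -/
theorem prob_straddle_left_closer (n r : ℕ) (hn : 1 ≤ n) (hr1 : 1 ≤ r) (hrn : r ≤ n - 1) :
    unifCube n {x | orderStat x ⟨r - 1, by omega⟩ < 1/2 ∧ 1/2 < orderStat x ⟨r, by omega⟩ ∧
        |orderStat x ⟨r - 1, by omega⟩ - 1/2| ≤ |orderStat x ⟨r, by omega⟩ - 1/2|} =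
      ENNReal.ofReal ((n.choose r : ℝ) * (1 / 2 ^ n) * (r / n)) := by
  obtain ⟨m, rfl⟩ : ∃ m, n = m + 1 := ⟨n - 1, by omega⟩
  have hpq : (⟨r, by omega⟩ : Fin (m + 1)).val = (⟨r - 1, by omega⟩ : Fin (m + 1)).val + 1 := by
    simp only
    omega
  simp only [straddle_iff]
  rw [straddle_eq_biUnion hpq, measure_biUnion_finset (pairwiseDisjoint_straddleCell hpq)
    fun a _ => measurableSet_straddleCell a.1 a.2]
  simp only [unifCube_straddleCell, Finset.sum_const, Finset.card_sigma]
  rw [Finset.sum_congr rfl fun S hS => (Finset.mem_powersetCard.1 hS).2]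
  simp only [Finset.sum_const, Finset.card_powersetCard, Finset.card_univ, Fintype.card_fin,
    smul_eq_mul]
  rw [← ENNReal.ofReal_nsmul, nsmul_eq_mul]
  congr 1
  push_cast
  rw [one_div_pow]
  ring
end

section
/- For every ε with 0 < ε < 1 there exists N such that for all n ≥ N the following hold: (i) every natural number r with n/2 − ((1−ε)/2)·√(n · ln(2n/π)) ≤ r ≤ n/2 satisfies C(n−2, r−1) ≥ 2^(n−2)/(n−1); and (ii) every natural number r with 1 ≤ r ≤ n/2 − ((1+ε)/2)·√(n · ln(2n/π)) satisfies C(n−2, r−1) < 2^(n−2)/(n−1). -/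
open Real Filter

/-- Two-sided bound on the central binomial coefficient, squared to avoid roots. -/
lemma sq_centralBinom_bounds (a : ℕ) :
    (2 * a + 1 : ℝ) * (a.centralBinom : ℝ) ^ 2 ≤ 16 ^ a ∧
      (16 : ℝ) ^ a ≤ (4 * a + 1) * (a.centralBinom : ℝ) ^ 2 := by
  induction a with
  | zero => norm_num
  | succ a ih =>
    obtain ⟨hu, hl⟩ := ih
    have hrec : ((a : ℝ) + 1) * ((a + 1).centralBinom : ℝ) =
        2 * (2 * a + 1) * (a.centralBinom : ℝ) := by
      exact_mod_cast Nat.succ_mul_centralBinom_succ a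
    have hsq : ((a : ℝ) + 1) ^ 2 * ((a + 1).centralBinom : ℝ) ^ 2 =
        4 * (2 * a + 1) ^ 2 * (a.centralBinom : ℝ) ^ 2 := by
      rw [← mul_pow, hrec]; ring
    have ha : (0 : ℝ) ≤ a := a.cast_nonneg
    have hpos : (0 : ℝ) < ((a : ℝ) + 1) ^ 2 := by positivity
    push_cast
    constructor
    · refine le_of_mul_le_mul_left ?_ hpos
      calc ((a : ℝ) + 1) ^ 2 * ((2 * (a + 1) + 1) * ((a + 1).centralBinom : ℝ) ^ 2)
          = (4 * (2 * a + 1) * (2 * a + 3)) * ((2 * a + 1) * (a.centralBinom : ℝ) ^ 2) := by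
            linear_combination (2 * (a : ℝ) + 3) * hsq
        _ ≤ (16 * ((a : ℝ) + 1) ^ 2) * 16 ^ a := by
            gcongr ?_ * ?_
            nlinarith
        _ = ((a : ℝ) + 1) ^ 2 * 16 ^ (a + 1) := by ring
    · refine le_of_mul_le_mul_left ?_ hpos
      calc ((a : ℝ) + 1) ^ 2 * 16 ^ (a + 1)
          = (16 * ((a : ℝ) + 1) ^ 2) * 16 ^ a := by ring
        _ ≤ (16 * ((a : ℝ) + 1) ^ 2) * ((4 * a + 1) * (a.centralBinom : ℝ) ^ 2) := by gcongr
        _ = (16 * ((a : ℝ) + 1) ^ 2 * (4 * a + 1)) * (a.centralBinom : ℝ) ^ 2 := by ring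
        _ ≤ (4 * (4 * a + 5) * (2 * a + 1) ^ 2) * (a.centralBinom : ℝ) ^ 2 := by
            gcongr ?_ * _
            nlinarith
        _ = ((a : ℝ) + 1) ^ 2 * ((4 * (a + 1) + 1) * ((a + 1).centralBinom : ℝ) ^ 2) := by
            linear_combination -(4 * (a : ℝ) + 5) * hsq

/-- Two-sided bound on the middle binomial coefficient in either parity. -/
lemma sq_choose_half_bounds (m : ℕ) :
    (m + 1 : ℝ) * (m.choose (m / 2) : ℝ) ^ 2 ≤ 4 ^ m ∧
      (4 : ℝ) ^ m ≤ (2 * m + 3) * (m.choose (m / 2) : ℝ) ^ 2 := by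
  obtain ⟨a, rfl | rfl⟩ := m.even_or_odd'
  · obtain ⟨hu, hl⟩ := sq_centralBinom_bounds a
    have h16 : (4 : ℝ) ^ (2 * a) = 16 ^ a := by rw [pow_mul]; norm_num
    rw [Nat.mul_div_cancel_left a two_pos, ← Nat.centralBinom_eq_two_mul_choose, h16]
    push_cast
    exact ⟨hu, hl.trans (by gcongr ?_ * _; linarith)⟩
  · obtain ⟨hu, hl⟩ := sq_centralBinom_bounds (a + 1)
    have h16 : (16 : ℝ) ^ (a + 1) = 4 * 4 ^ (2 * a + 1) := by
      rw [pow_succ 4, pow_mul]; norm_num; ring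
    have hhalf : (2 * a + 1) / 2 = a := by omega
    have hc : ((a + 1).centralBinom : ℝ) = 2 * ((2 * a + 1).choose a : ℝ) := by
      have h : (a + 1).centralBinom = 2 * (2 * a + 1).choose a := by
        rw [Nat.centralBinom_eq_two_mul_choose, show 2 * (a + 1) = 2 * a + 1 + 1 by ring,
          Nat.choose_succ_succ, ← Nat.choose_symm_half]
        ring
      exact_mod_cast h
    rw [hhalf]
    rw [hc, h16] at hu hl
    push_cast at hu hl ⊢
    constructor
    · nlinarith [sq_nonneg ((2 * a + 1).choose a : ℝ)]
    · nlinarith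

/-- `1 - x ≤ (1 + x) e^{-2x}` for `0 ≤ x < 1`. -/
lemma one_sub_mul_exp_le {x : ℝ} (hx0 : 0 ≤ x) (hx1 : x < 1) :
    (1 - x) * exp (2 * x) ≤ 1 + x := by
  have hs := hasSum_log_sub_log_of_abs_lt_one (abs_lt.2 ⟨by linarith, hx1⟩)
  have hle : 2 * x ≤ log (1 + x) - log (1 - x) := by
    have := sum_le_hasSum (Finset.range 1) (fun k _ => by positivity) hs
    simpa using this
  have hpos : 0 < 1 - x := by linarith
  calc (1 - x) * exp (2 * x) ≤ (1 - x) * exp (log (1 + x) - log (1 - x)) := by gcongr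
    _ = 1 + x := by
      rw [exp_sub, exp_log (by linarith), exp_log hpos]
      field_simp

lemma choose_mul_exp_le_succ {m k : ℕ} (hk : 2 * (k + 1) ≤ m) :
    (m.choose k : ℝ) * exp (2 * ((m : ℝ) / 2 - k) ^ 2 / (m + 1)) ≤
      m.choose (k + 1) * exp (2 * ((m : ℝ) / 2 - (k + 1 : ℕ)) ^ 2 / (m + 1)) := by
  have hk' : 2 * ((k : ℝ) + 1) ≤ m := by exact_mod_cast hk
  have hk0 : (0 : ℝ) ≤ k := k.cast_nonneg
  have hm : (0 : ℝ) < m + 1 := by linarith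
  have hch : (m.choose (k + 1) : ℝ) * (k + 1) = m.choose k * (m - k) := by
    have h := Nat.choose_succ_right_eq m k
    rw [← Nat.cast_sub (by omega : k ≤ m)]
    exact_mod_cast h
  set x : ℝ := (m - 2 * k - 1) / (m + 1) with hx
  have hx0 : 0 ≤ x := by apply div_nonneg <;> linarith
  have hx1 : x < 1 := by rw [hx, div_lt_one hm]; linarith
  have hstep : ((k : ℝ) + 1) * exp (2 * x) ≤ m - k := by
    have h := one_sub_mul_exp_le hx0 hx1
    have h1 : (k : ℝ) + 1 = (m + 1) / 2 * (1 - x) := by rw [hx]; field_simp; ring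
    have h2 : (m : ℝ) - k = (m + 1) / 2 * (1 + x) := by rw [hx]; field_simp; ring
    rw [h1, h2, mul_assoc]
    gcongr
  have hexp : 2 * ((m : ℝ) / 2 - k) ^ 2 / (m + 1) =
      2 * x + 2 * ((m : ℝ) / 2 - (k + 1 : ℕ)) ^ 2 / (m + 1) := by
    rw [hx]; push_cast; field_simp; ring
  rw [hexp, exp_add, ← mul_assoc]
  gcongr
  refine le_of_mul_le_mul_right ?_ (by linarith : (0 : ℝ) < k + 1)
  rw [hch]
  calc (m.choose k : ℝ) * exp (2 * x) * (k + 1) = m.choose k * ((k + 1) * exp (2 * x)) := by ring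
    _ ≤ _ := by gcongr

lemma choose_succ_mul_exp_le {m k : ℕ} {γ : ℝ} (hk : 2 * (k + 1) ≤ m) (hγ : 1 ≤ γ * (k + 1)) :
    (m.choose (k + 1) : ℝ) * exp (γ * ((m : ℝ) / 2 - (k + 1 : ℕ)) ^ 2) ≤
      m.choose k * exp (γ * ((m : ℝ) / 2 - k) ^ 2) := by
  have hk' : 2 * ((k : ℝ) + 1) ≤ m := by exact_mod_cast hk
  have hk0 : (0 : ℝ) < (k : ℝ) + 1 := by positivity
  have hch : (m.choose (k + 1) : ℝ) * (k + 1) = m.choose k * (m - k) := by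
    have h := Nat.choose_succ_right_eq m k
    rw [← Nat.cast_sub (by omega : k ≤ m)]
    exact_mod_cast h
  have hstep : (m : ℝ) - k ≤ exp (γ * (m - 2 * k - 1)) * (k + 1) := by
    have h := add_one_le_exp (γ * ((m : ℝ) - 2 * k - 1))
    nlinarith [mul_le_mul_of_nonneg_right hγ (by linarith : (0 : ℝ) ≤ m - 2 * k - 1)]
  have hexp : γ * ((m : ℝ) / 2 - k) ^ 2 =
      γ * (m - 2 * k - 1) + γ * ((m : ℝ) / 2 - (k + 1 : ℕ)) ^ 2 := by
    push_cast; ring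
  rw [hexp, exp_add, ← mul_assoc]
  gcongr
  refine le_of_mul_le_mul_right ?_ hk0
  rw [hch, mul_assoc]
  gcongr

/-- Gaussian upper bound relative to the middle binomial coefficient. -/
lemma choose_mul_exp_le_choose_half {m k : ℕ} (hk : k ≤ m / 2) :
    (m.choose k : ℝ) * exp (2 * ((m : ℝ) / 2 - k) ^ 2 / (m + 1)) ≤
      m.choose (m / 2) * exp (2 * ((m : ℝ) / 2 - (m / 2 : ℕ)) ^ 2 / (m + 1)) := by
  induction hk using Nat.decreasingInduction with
  | self => rfl
  | of_succ k hk ih => exact (choose_mul_exp_le_succ (by omega)).trans ih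

/-- Gaussian lower bound relative to the middle binomial coefficient. -/
lemma choose_half_le_choose_mul_exp {m k : ℕ} {γ : ℝ} (hk : k ≤ m / 2) (hγ0 : 0 ≤ γ)
    (hγ : 1 ≤ γ * (k + 1)) :
    (m.choose (m / 2) : ℝ) ≤ m.choose k * exp (γ * ((m : ℝ) / 2 - k) ^ 2) := by
  induction hk using Nat.decreasingInduction with
  | self => exact le_mul_of_one_le_right (by positivity) (one_le_exp (by positivity))
  | of_succ k hk ih =>
    refine (ih ?_).trans (choose_succ_mul_exp_le (by omega) hγ)
    push_cast
    nlinarith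

/-- Upper half of the threshold, with `ℓ` standing for `ln (2n/π)`. -/
lemma choose_lt_of_sq_dev_ge {m k : ℕ} {ε ℓ : ℝ} (hε : 0 < ε) (hk : k ≤ m / 2)
    (hℓ : 0 ≤ ℓ) (hn : (m : ℝ) + 2 ≤ 4 * exp ℓ) (hlarge : 6 < exp (ε * ℓ))
    (hd : (1 + ε) ^ 2 * ((m + 2) * ℓ) ≤ 4 * ((m : ℝ) / 2 - k) ^ 2) :
    (m.choose k : ℝ) < 2 ^ m / (m + 1) := by
  have hm0 : (0 : ℝ) ≤ m := m.cast_nonneg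
  have hm : (0 : ℝ) < m + 1 := by positivity
  have hmain := choose_mul_exp_le_choose_half hk
  have hB := (sq_choose_half_bounds m).1
  set B : ℝ := (m.choose (m / 2) : ℝ)
  have hcenter : exp (2 * ((m : ℝ) / 2 - (m / 2 : ℕ)) ^ 2 / (m + 1)) ≤ 3 := by
    have hfrac : 2 * ((m : ℝ) / 2 - (m / 2 : ℕ)) ^ 2 / (m + 1) ≤ 1 := by
      have h1 : (2 * (m / 2 : ℕ) : ℝ) ≤ m := by exact_mod_cast Nat.mul_div_le m 2
      have h2 : (m : ℝ) ≤ 2 * (m / 2 : ℕ) + 1 := by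
        exact_mod_cast (by omega : m ≤ 2 * (m / 2) + 1)
      rw [div_le_one hm]
      nlinarith
    exact (exp_le_exp.2 hfrac).trans (by linarith [exp_one_lt_d9])
  have hdev : ℓ / 2 + ε * ℓ ≤ 2 * ((m : ℝ) / 2 - k) ^ 2 / (m + 1) := by
    rw [le_div_iff₀ hm]
    nlinarith [mul_nonneg hℓ hm0, mul_nonneg (sq_nonneg ε) (mul_nonneg hℓ hm0),
      mul_nonneg hε.le hℓ, mul_nonneg (sq_nonneg ε) hℓ, mul_nonneg hε.le (mul_nonneg hℓ hm0)]
  have hBs : √(m + 1) * B ≤ 2 ^ m := by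
    refine le_of_sq_le_sq ?_ (by positivity)
    rw [mul_pow, sq_sqrt hm.le, ← pow_mul, mul_comm m, pow_mul]
    norm_num
    exact hB
  have hroot : √(m + 1) ≤ 2 * exp (ℓ / 2) := by
    rw [sqrt_le_left (by positivity), mul_pow, ← exp_nat_mul]
    push_cast
    rw [mul_div_cancel₀ _ two_ne_zero]
    linarith
  have hCpos : (0 : ℝ) < m.choose k := by
    exact_mod_cast Nat.choose_pos (hk.trans (Nat.div_le_self m 2))
  rw [lt_div_iff₀ hm]
  have hchain : (m.choose k : ℝ) * (exp (ℓ / 2) * exp (ε * ℓ)) ≤ B * 3 := by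
    rw [← exp_add]
    calc _ ≤ _ := by gcongr
      _ ≤ _ := hmain
      _ ≤ _ := by gcongr
  have hs : √((m : ℝ) + 1) * √(m + 1) = m + 1 := mul_self_sqrt hm.le
  have hsp : 0 < √((m : ℝ) + 1) := sqrt_pos.2 hm
  have he := exp_pos (ℓ / 2)
  have h6 : (m.choose k : ℝ) * (exp (ℓ / 2) * 6) < B * 3 := lt_of_lt_of_le (by gcongr) hchain
  calc (m.choose k : ℝ) * (m + 1) = √(m + 1) * (m.choose k * √(m + 1)) := by
        linear_combination -(m.choose k : ℝ) * hs
    _ ≤ √(m + 1) * (m.choose k * (2 * exp (ℓ / 2))) := by gcongr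
    _ < √(m + 1) * B := by gcongr; linarith
    _ ≤ 2 ^ m := hBs

/-- Lower half of the threshold, with `ℓ` standing for `ln (2n/π)`. -/
lemma le_choose_of_sq_dev_le {m k : ℕ} {ε ℓ : ℝ} (hε0 : 0 < ε) (hε1 : ε < 1) (hk : k ≤ m / 2)
    (hℓ : 0 ≤ ℓ) (hn : exp ℓ ≤ (m : ℝ) + 2) (hlarge : 9 ≤ exp (ε * ℓ))
    (hγ : (m : ℝ) + 2 ≤ 2 * (1 + ε) * (k + 1))
    (hd : 4 * ((m : ℝ) / 2 - k) ^ 2 ≤ (1 - ε) ^ 2 * ((m + 2) * ℓ)) :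
    (2 : ℝ) ^ m / (m + 1) ≤ m.choose k := by
  have hm0 : (0 : ℝ) ≤ m := m.cast_nonneg
  have hm : (0 : ℝ) < m + 2 := by positivity
  have hmain := choose_half_le_choose_mul_exp (γ := 2 * (1 + ε) / (m + 2)) hk (by positivity)
    (by rw [div_mul_eq_mul_div, le_div_iff₀ hm]; linarith)
  have hB := (sq_choose_half_bounds m).2
  have hdev : 2 * (1 + ε) / (m + 2) * ((m : ℝ) / 2 - k) ^ 2 ≤ (1 - ε) * ℓ / 2 := by
    rw [div_mul_eq_mul_div, div_le_iff₀ hm]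
    calc 2 * (1 + ε) * ((m : ℝ) / 2 - k) ^ 2
        = (1 + ε) / 2 * (4 * ((m : ℝ) / 2 - k) ^ 2) := by ring
      _ ≤ (1 + ε) / 2 * ((1 - ε) ^ 2 * ((m + 2) * ℓ)) := by gcongr
      _ = (1 - ε ^ 2) * ((1 - ε) * ℓ / 2 * (m + 2)) := by ring
      _ ≤ 1 * ((1 - ε) * ℓ / 2 * (m + 2)) := by
          have : 0 ≤ 1 - ε := by linarith
          gcongr
          nlinarith
      _ = _ := one_mul _
  have hsq : (m.choose (m / 2) : ℝ) ^ 2 * exp (ε * ℓ) ≤ (m.choose k : ℝ) ^ 2 * (m + 2) := by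
    have h1 : (m.choose (m / 2) : ℝ) ≤ m.choose k * exp ((1 - ε) * ℓ / 2) :=
      hmain.trans (by gcongr)
    calc (m.choose (m / 2) : ℝ) ^ 2 * exp (ε * ℓ)
        ≤ (m.choose k * exp ((1 - ε) * ℓ / 2)) ^ 2 * exp (ε * ℓ) := by gcongr
      _ = (m.choose k : ℝ) ^ 2 * exp ℓ := by
          rw [mul_pow, ← exp_nat_mul, mul_assoc, ← exp_add]
          congr 2
          push_cast
          ring
      _ ≤ _ := by gcongr
  rw [div_le_iff₀ (by positivity)]
  refine le_of_sq_le_sq ?_ (by positivity)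
  rw [← pow_mul, mul_comm m, pow_mul, mul_pow]
  norm_num
  have h9 : (m.choose (m / 2) : ℝ) ^ 2 * 9 ≤ (m.choose k : ℝ) ^ 2 * (m + 2) :=
    le_trans (by gcongr) hsq
  have hpoly : (2 * (m : ℝ) + 3) * (m + 2) ≤ 9 * (m + 1) ^ 2 := by nlinarith
  have hmul := mul_le_mul_of_nonneg_left h9 (by positivity : (0 : ℝ) ≤ 2 * m + 3)
  have hmul' := mul_le_mul_of_nonneg_left hpoly (sq_nonneg (m.choose k : ℝ))
  nlinarith

/-- Asymptotically, the solutions `r ≤ n/2` of `C(n-2, r-1) ≥ 2^(n-2)/(n-1)` are exactly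
those with `r ≥ n/2 - (1/2)√(n ln(2n/π))`: for every `0 < ε < 1` and all large `n`,
(i) every `r` with `n/2 - ((1-ε)/2)√(n ln(2n/π)) ≤ r ≤ n/2` satisfies the inequality, and
(ii) every `r ≥ 1` with `r ≤ n/2 - ((1+ε)/2)√(n ln(2n/π))` fails it. -/
theorem stopping_threshold_asymptotic (ε : ℝ) (hε0 : 0 < ε) (hε1 : ε < 1) :
    ∃ N : ℕ, ∀ n : ℕ, N ≤ n →
      (∀ r : ℕ,
        (n : ℝ) / 2 - (1 - ε) / 2 * Real.sqrt (n * Real.log (2 * n / Real.pi)) ≤ r →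
        (r : ℝ) ≤ n / 2 →
        (2 : ℝ) ^ (n - 2) / (n - 1) ≤ ((n - 2).choose (r - 1) : ℝ)) ∧
      (∀ r : ℕ, 1 ≤ r →
        (r : ℝ) ≤ (n : ℝ) / 2 - (1 + ε) / 2 * Real.sqrt (n * Real.log (2 * n / Real.pi)) →
        ((n - 2).choose (r - 1) : ℝ) < (2 : ℝ) ^ (n - 2) / (n - 1)) := by
  have hlin : Tendsto (fun n : ℕ => 2 * (n : ℝ) / π) atTop atTop :=
    (tendsto_natCast_atTop_atTop.const_mul_atTop two_pos).atTop_div_const pi_pos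
  have hlog : Tendsto (fun n : ℕ => log (2 * n / π)) atTop atTop :=
    tendsto_log_atTop.comp hlin
  have hsmall : ∀ᶠ n : ℕ in atTop, log (2 * n / π) ≤ ε ^ 2 / 4 * n := by
    have ho := (isLittleO_log_id_atTop.comp_tendsto hlin).bound
      (by positivity : (0 : ℝ) < ε ^ 2 / 4)
    filter_upwards [ho] with n hn
    have hn0 : (0 : ℝ) ≤ n := n.cast_nonneg
    simp only [Function.comp, id, norm_eq_abs] at hn
    rw [abs_of_nonneg (by positivity : (0 : ℝ) ≤ 2 * n / π)] at hn
    refine (le_abs_self _).trans (hn.trans ?_)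
    gcongr
    rw [div_le_iff₀ pi_pos]
    nlinarith [pi_gt_three]
  have hexp : ∀ᶠ n : ℕ in atTop, 9 ≤ exp (ε * log (2 * n / π)) :=
    (tendsto_exp_atTop.comp (hlog.const_mul_atTop hε0)).eventually_ge_atTop 9
  obtain ⟨N, hN⟩ := eventually_atTop.1
    (((hlog.eventually_ge_atTop 0).and hsmall).and (hexp.and (eventually_ge_atTop 2)))
  refine ⟨N, fun n hn => ?_⟩
  obtain ⟨⟨hℓ, hℓn⟩, h9, hn2⟩ := hN n hn
  obtain ⟨m, rfl⟩ : ∃ m, n = m + 2 := ⟨n - 2, by omega⟩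
  clear hN hn hn2 hlin hlog hsmall hexp
  have hcast : ((m + 2 : ℕ) : ℝ) = m + 2 := by push_cast; ring
  have hm0 : (0 : ℝ) ≤ m := m.cast_nonneg
  have hel : exp (log (2 * (m + 2 : ℕ) / π)) = 2 * (m + 2) / π := by
    rw [hcast, exp_log (by positivity)]
  set ℓ := log (2 * (m + 2 : ℕ) / π)
  rw [hcast] at hℓn ⊢
  rw [Nat.add_sub_cancel, show (m : ℝ) + 2 - 1 = m + 1 by ring]
  set S := √(((m : ℝ) + 2) * ℓ)
  have hS0 : 0 ≤ S := sqrt_nonneg _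
  have hSsq : S ^ 2 = (m + 2) * ℓ := sq_sqrt (by positivity)
  constructor
  · intro r hlo hhi
    have hSle : S ≤ ε / 2 * (m + 2) := by
      refine le_of_sq_le_sq ?_ (by positivity)
      rw [hSsq]
      nlinarith
    have hrpos : ((m : ℝ) + 2) ≤ 2 * (1 + ε) * r := by
      nlinarith [mul_nonneg hε0.le hS0]
    obtain ⟨k, rfl⟩ : ∃ k, r = k + 1 := by
      refine Nat.exists_eq_succ_of_ne_zero ?_
      rintro rfl
      norm_num at hrpos
      linarith
    have hkm : k ≤ m / 2 := by
      have : 2 * (k + 1) ≤ m + 2 := by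
        have : (2 : ℝ) * ((k + 1 : ℕ) : ℝ) ≤ m + 2 := by linarith
        exact_mod_cast this
      omega
    push_cast at hlo hhi hrpos
    rw [Nat.add_sub_cancel]
    refine le_choose_of_sq_dev_le hε0 hε1 hkm hℓ ?_ h9 hrpos ?_
    · rw [hel, div_le_iff₀ pi_pos]
      nlinarith [pi_gt_three]
    · rw [← hSsq]
      have h1 : 2 * ((m : ℝ) / 2 - k) ≤ (1 - ε) * S := by linarith
      have h2 : 0 ≤ 2 * ((m : ℝ) / 2 - k) := by linarith
      nlinarith [pow_le_pow_left₀ h2 h1 2]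
  · intro r hr hle
    obtain ⟨k, rfl⟩ : ∃ k, r = k + 1 := ⟨r - 1, by omega⟩
    push_cast at hle
    rw [Nat.add_sub_cancel]
    have h0 : 0 ≤ (1 + ε) * S := by positivity
    have hkm : k ≤ m / 2 := by
      have : 2 * k ≤ m := by
        have : (2 : ℝ) * k ≤ m := by linarith
        exact_mod_cast this
      omega
    refine choose_lt_of_sq_dev_ge hε0 hkm hℓ ?_ (by linarith) ?_
    · rw [hel, ← mul_div_assoc, le_div_iff₀ pi_pos]
      nlinarith [pi_lt_four]
    · rw [← hSsq]
      have h1 : (1 + ε) * S ≤ 2 * ((m : ℝ) / 2 - k) := by linarith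
      nlinarith [pow_le_pow_left₀ h0 h1 2]
end

section
/- Fix a positive integer w and define, for natural s with s ≥ 2w, a_s = (1/2^s) · gbinom(s, s/2 − w). Then for all natural numbers m with m > 2w² − 1 one has a_{2(m+1)} < a_{2m}, and a_{2(m+1)+1} < a_{2m+1}; that is, beyond 2w² − 1 both the even-indexed and the odd-indexed subsequences of (a_s) are strictly decreasing. -/
/-- The generalized binomial coefficient `gbinom n z = Γ(n+1) / (Γ(z+1) Γ(n-z+1))`. -/
noncomputable def gbinom (n : ℕ) (z : ℝ) : ℝ :=
  Real.Gamma (n + 1) / (Real.Gamma (z + 1) * Real.Gamma ((n : ℝ) - z + 1))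

/-- Raising the upper index by two and the lower index by one multiplies `gbinom s z` by
`(s+2)(s+1) / ((z+1)(s-z+1))`. -/
theorem gbinom_add_two (s : ℕ) {z : ℝ} (hz : z + 1 ≠ 0) (hsz : (s : ℝ) - z + 1 ≠ 0) :
    gbinom (s + 2) (z + 1) =
      ((s + 2) * (s + 1)) / ((z + 1) * ((s : ℝ) - z + 1)) * gbinom s z := by
  have h₁ : Real.Gamma (((s + 2 : ℕ) : ℝ) + 1) = (s + 2) * ((s + 1) * Real.Gamma (s + 1)) := by
    rw [← Real.Gamma_add_one (by positivity : (s : ℝ) + 1 ≠ 0), add_assoc (s : ℝ) 1 1,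
      one_add_one_eq_two, ← Real.Gamma_add_one (by positivity : (s : ℝ) + 2 ≠ 0)]
    push_cast
    rfl
  have h₂ : Real.Gamma (((s + 2 : ℕ) : ℝ) - (z + 1) + 1) =
      ((s : ℝ) - z + 1) * Real.Gamma ((s : ℝ) - z + 1) := by
    rw [← Real.Gamma_add_one hsz]
    congr 1
    push_cast
    ring
  rw [gbinom, gbinom, h₁, h₂, Real.Gamma_add_one hz, div_mul_div_comm]
  congr 1 <;> ring

theorem gbinom_pos (s : ℕ) {z : ℝ} (hz : 0 < z + 1) (hsz : 0 < (s : ℝ) - z + 1) :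
    0 < gbinom s z :=
  div_pos (Real.Gamma_pos_of_pos (by positivity))
    (mul_pos (Real.Gamma_pos_of_pos hz) (Real.Gamma_pos_of_pos hsz))

theorem scaled_gbinom_add_two_lt (s : ℕ) {w : ℝ} (hw : 1 ≤ w) (hs : 4 * w ^ 2 < s + 2) :
    1 / 2 ^ (s + 2) * gbinom (s + 2) (((s + 2 : ℕ) : ℝ) / 2 - w) <
      1 / 2 ^ s * gbinom s ((s : ℝ) / 2 - w) := by
  have hz : 0 < (s : ℝ) / 2 - w + 1 := by nlinarith
  have hsz : 0 < (s : ℝ) - ((s : ℝ) / 2 - w) + 1 := by linarith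
  have hshift : ((s + 2 : ℕ) : ℝ) / 2 - w = ((s : ℝ) / 2 - w) + 1 := by
    push_cast
    ring
  have hratio : ((s : ℝ) + 2) * (s + 1) /
      (((s : ℝ) / 2 - w + 1) * ((s : ℝ) - ((s : ℝ) / 2 - w) + 1)) < 4 := by
    rw [div_lt_iff₀ (mul_pos hz hsz)]
    nlinarith
  rw [hshift, gbinom_add_two s hz.ne' hsz.ne']
  calc _ < 1 / 2 ^ (s + 2) * (4 * gbinom s ((s : ℝ) / 2 - w)) := by
        have := gbinom_pos s hz hsz
        gcongr
    _ = _ := by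
        rw [pow_add]
        field_simp
        norm_num

/-- For a fixed positive integer `w`, let `a s = (1/2^s) · gbinom s (s/2 - w)`.  Then for all
`m > 2w² - 1` we have `a (2(m+1)) < a (2m)` and `a (2(m+1)+1) < a (2m+1)`: both the
even-indexed and the odd-indexed subsequences of `a` are eventually strictly decreasing. -/
theorem a_subsequences_decreasing (w : ℕ) (hw : 0 < w) (a : ℕ → ℝ)
    (ha : ∀ s, a s = (1 / 2 ^ s) * gbinom s ((s : ℝ) / 2 - w)) :
    ∀ m : ℕ, (2 * (w : ℝ) ^ 2 - 1 : ℝ) < m →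
      a (2 * (m + 1)) < a (2 * m) ∧ a (2 * (m + 1) + 1) < a (2 * m + 1) := by
  intro m hm
  have hw' : (1 : ℝ) ≤ w := by exact_mod_cast hw
  simp only [ha]
  constructor
  · exact scaled_gbinom_add_two_lt (2 * m) hw' (by push_cast; linarith)
  · exact scaled_gbinom_add_two_lt (2 * m + 1) hw' (by push_cast; linarith)
end

section
/- Let s, w, and n be positive integers such that n > s and s > 4w². Then (1/2^(s−1)) · C(s−1, ⌈s/2⌉ − w) ≥ (1/2^(n−1)) · gbinom(n−1, (n−1)/2 − w). -/
theorem gbinom_natCast {n k : ℕ} (h : k ≤ n) : gbinom n (k : ℝ) = n.choose k := by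
  rw [gbinom, ← Nat.cast_sub h, Real.Gamma_nat_eq_factorial, Real.Gamma_nat_eq_factorial,
    Real.Gamma_nat_eq_factorial, Nat.cast_choose ℝ h]

/-- Log-convexity of `Γ`: moving two arguments towards each other decreases the product. -/
theorem Gamma_mul_Gamma_le {a b t : ℝ} (ha : 0 < a) (hb : 0 < b) (ht : 0 < t) (ht' : t < 1) :
    Real.Gamma ((1 - t) * a + t * b) * Real.Gamma (t * a + (1 - t) * b) ≤
      Real.Gamma a * Real.Gamma b := by
  have hA := Real.Gamma_pos_of_pos ha
  have hB := Real.Gamma_pos_of_pos hb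
  have hs : 0 < 1 - t := sub_pos.2 ht'
  have h₁ := Real.Gamma_mul_add_mul_le_rpow_Gamma_mul_rpow_Gamma ha hb hs ht (by ring)
  have h₂ := Real.Gamma_mul_add_mul_le_rpow_Gamma_mul_rpow_Gamma ha hb ht hs (by ring)
  calc _ ≤ (Real.Gamma a ^ (1 - t) * Real.Gamma b ^ t) *
        (Real.Gamma a ^ t * Real.Gamma b ^ (1 - t)) :=
        mul_le_mul h₁ h₂ (Real.Gamma_pos_of_pos (by positivity)).le (by positivity)
    _ = (Real.Gamma a ^ (1 - t) * Real.Gamma a ^ t) *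
        (Real.Gamma b ^ t * Real.Gamma b ^ (1 - t)) := by ring
    _ = Real.Gamma a * Real.Gamma b := by
        rw [← Real.rpow_add hA, ← Real.rpow_add hB]
        simp

/-- The normalized generalized binomial coefficient at distance `w` from the centre. -/
noncomputable def centralTerm (w m : ℕ) : ℝ :=
  1 / 2 ^ m * gbinom m ((m : ℝ) / 2 - w)

theorem centralTerm_add_two_le {w m : ℕ} (hw : 0 < w) (h : 4 * w ^ 2 ≤ m + 2) :
    centralTerm w (m + 2) ≤ centralTerm w m := by
  have hR : 4 * (w : ℝ) ^ 2 ≤ m + 2 := by exact_mod_cast h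
  have hw' : (1 : ℝ) ≤ w := by exact_mod_cast hw
  have hx : 0 < (m : ℝ) / 2 - w + 1 := by nlinarith
  have hy : 0 < (m : ℝ) - (m / 2 - w) + 1 := by linarith
  have hX := Real.Gamma_pos_of_pos hx
  have hY := Real.Gamma_pos_of_pos hy
  have hm : (0 : ℝ) < m + 1 := by positivity
  have hM := Real.Gamma_pos_of_pos hm
  unfold centralTerm gbinom
  have e₁ : Real.Gamma (((m + 2 : ℕ) : ℝ) + 1) = (m + 2) * ((m + 1) * Real.Gamma (m + 1)) := by
    rw [← Real.Gamma_add_one hm.ne', ← show (m : ℝ) + 1 + 1 = m + 2 by ring,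
      ← Real.Gamma_add_one (by positivity)]
    push_cast
    ring_nf
  have e₂ : Real.Gamma (((m + 2 : ℕ) : ℝ) / 2 - w + 1) =
      ((m : ℝ) / 2 - w + 1) * Real.Gamma ((m : ℝ) / 2 - w + 1) := by
    rw [← Real.Gamma_add_one hx.ne']
    push_cast
    ring_nf
  have e₃ : Real.Gamma (((m + 2 : ℕ) : ℝ) - (((m + 2 : ℕ) : ℝ) / 2 - w) + 1) =
      ((m : ℝ) - (m / 2 - w) + 1) * Real.Gamma ((m : ℝ) - (m / 2 - w) + 1) := by
    rw [← Real.Gamma_add_one hy.ne']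
    push_cast
    ring_nf
  rw [e₁, e₂, e₃]
  have hratio : ((m : ℝ) + 2) * (m + 1) / (4 * ((m / 2 - w + 1) * (m - (m / 2 - w) + 1))) ≤ 1 := by
    rw [div_le_one (by positivity)]
    nlinarith
  calc _ = ((m : ℝ) + 2) * (m + 1) / (4 * ((m / 2 - w + 1) * (m - (m / 2 - w) + 1))) *
        (1 / 2 ^ m * (Real.Gamma (m + 1) / (Real.Gamma ((m : ℝ) / 2 - w + 1) *
          Real.Gamma ((m : ℝ) - (m / 2 - w) + 1)))) := by
        generalize (m : ℝ) / 2 - w + 1 = x at *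
        generalize (m : ℝ) - (m / 2 - w) + 1 = y at *
        field_simp
        ring
    _ ≤ _ := mul_le_of_le_one_left (by positivity) hratio

theorem centralTerm_add_two_mul_le {w m : ℕ} (hw : 0 < w) (h : 4 * w ^ 2 ≤ m + 2) (j : ℕ) :
    centralTerm w (m + 2 * j) ≤ centralTerm w m := by
  induction j with
  | zero => exact le_rfl
  | succ j ih => exact (centralTerm_add_two_le (m := m + 2 * j) hw (by lia)).trans ih

theorem centralTerm_two_mul {w k : ℕ} (h : w ≤ k) :
    centralTerm w (2 * k) = 1 / 2 ^ (2 * k) * ((2 * k).choose (k - w) : ℝ) := by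
  rw [centralTerm, ← gbinom_natCast (by lia), Nat.cast_sub h]
  push_cast
  ring_nf

theorem centralTerm_two_mul_add_one_le {w k : ℕ} (hw : 0 < w) (h : w ≤ k + 1) :
    centralTerm w (2 * k + 1) ≤
      1 / 2 ^ (2 * k + 1) * ((2 * k + 1).choose (k + 1 - w) : ℝ) := by
  rw [centralTerm, ← gbinom_natCast (by lia), Nat.cast_sub h]
  have hw' : (1 : ℝ) ≤ w := by exact_mod_cast hw
  have h' : (w : ℝ) ≤ k + 1 := by exact_mod_cast h
  have ht : 1 / (4 * (w : ℝ)) < 1 := by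
    rw [div_lt_one (by positivity)]
    linarith
  have key := Gamma_mul_Gamma_le (a := k + 3 / 2 - w) (b := k + 3 / 2 + w)
    (by linarith) (by linarith) (by positivity) ht
  have e₁ : (1 - 1 / (4 * (w : ℝ))) * (k + 3 / 2 - w) + 1 / (4 * w) * (k + 3 / 2 + w) =
      k + 1 - w + 1 := by
    field_simp
    ring
  have e₂ : 1 / (4 * (w : ℝ)) * (k + 3 / 2 - w) + (1 - 1 / (4 * w)) * (k + 3 / 2 + w) =
      2 * k + 1 - (k + 1 - w) + 1 := by
    field_simp
    ring
  rw [e₁, e₂] at key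
  have hpos := mul_pos (Real.Gamma_pos_of_pos (show (0 : ℝ) < k + 1 - w + 1 by linarith))
    (Real.Gamma_pos_of_pos (show (0 : ℝ) < 2 * k + 1 - (k + 1 - w) + 1 by linarith))
  unfold gbinom
  push_cast
  rw [show (2 * (k : ℝ) + 1) / 2 - w + 1 = k + 3 / 2 - w by ring,
    show 2 * (k : ℝ) + 1 - ((2 * k + 1) / 2 - w) + 1 = k + 3 / 2 + w by ring]
  have hM := Real.Gamma_pos_of_pos (show (0 : ℝ) < 2 * k + 1 + 1 by positivity)
  gcongr

theorem choose_succ_succ_le_two_mul {m r : ℕ} (h : r < m / 2) :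
    (m + 1).choose (r + 1) ≤ 2 * m.choose (r + 1) := by
  have := Nat.choose_le_succ_of_lt_half_left h
  rw [Nat.choose_succ_succ']
  lia

theorem normalized_choose_succ_le {m r : ℕ} (h : r < m / 2) :
    1 / 2 ^ (m + 1) * ((m + 1).choose (r + 1) : ℝ) ≤ 1 / 2 ^ m * (m.choose (r + 1) : ℝ) := by
  have : ((m + 1).choose (r + 1) : ℝ) ≤ 2 * m.choose (r + 1) := by
    exact_mod_cast choose_succ_succ_le_two_mul h
  calc _ ≤ 1 / 2 ^ (m + 1) * (2 * (m.choose (r + 1) : ℝ)) := by gcongr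
    _ = _ := by
      rw [pow_succ]
      field_simp

/-- If `s`, `w`, `n` are positive integers with `n > s` and `s > 4w²`, then
`(1/2^(s-1)) · C(s-1, ⌈s/2⌉ - w) ≥ (1/2^(n-1)) · gbinom (n-1) ((n-1)/2 - w)`. -/
theorem binom_term_monotone (s w n : ℕ) (hs : 0 < s) (hw : 0 < w) (hn : 0 < n)
    (hns : s < n) (hsw : 4 * w ^ 2 < s) :
    (1 / 2 ^ (n - 1) : ℝ) * gbinom (n - 1) (((n : ℝ) - 1) / 2 - w) ≤
      (1 / 2 ^ (s - 1) : ℝ) * (((s - 1).choose (⌈(s : ℝ) / 2⌉₊ - w) : ℕ) : ℝ) := by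
  obtain ⟨m, rfl⟩ : ∃ m, n = m + 1 := ⟨n - 1, by lia⟩
  have hww : w ≤ w ^ 2 := Nat.le_self_pow two_ne_zero w
  have hm : (((m + 1 : ℕ) : ℝ) - 1) / 2 - w = (m : ℝ) / 2 - w := by
    push_cast
    ring
  rw [hm, Nat.add_sub_cancel]
  change centralTerm w m ≤ _
  obtain ⟨k, rfl | rfl⟩ := Nat.even_or_odd' s
  · have hc : ⌈((2 * k : ℕ) : ℝ) / 2⌉₊ = k := by
      rw [Nat.cast_mul, Nat.cast_ofNat, mul_div_cancel_left₀ _ two_ne_zero, Nat.ceil_natCast]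
    obtain ⟨l, rfl⟩ : ∃ l, k = l + 1 := ⟨k - 1, by lia⟩
    rw [hc, show 2 * (l + 1) - 1 = 2 * l + 1 by lia]
    obtain ⟨i, rfl | rfl⟩ := Nat.even_or_odd' m
    · obtain ⟨j, rfl⟩ : ∃ j, i = l + 1 + j := ⟨i - (l + 1), by lia⟩
      rw [mul_add]
      refine (centralTerm_add_two_mul_le hw (by lia) j).trans ?_
      rw [centralTerm_two_mul (by lia), show l + 1 - w = l - w + 1 by lia]
      exact normalized_choose_succ_le (m := 2 * l + 1) (by lia)
    · obtain ⟨j, rfl⟩ : ∃ j, i = l + j := ⟨i - l, by lia⟩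
      rw [show 2 * (l + j) + 1 = 2 * l + 1 + 2 * j by ring]
      exact (centralTerm_add_two_mul_le hw (by lia) j).trans
        (centralTerm_two_mul_add_one_le hw (by lia))
  · have hc : ⌈((2 * k + 1 : ℕ) : ℝ) / 2⌉₊ = k + 1 := by
      rw [Nat.ceil_eq_iff (by lia)]
      push_cast
      constructor <;> linarith
    rw [hc, Nat.add_sub_cancel, show k + 1 - w = k - w + 1 by lia]
    obtain ⟨i, rfl | rfl⟩ := Nat.even_or_odd' m
    · obtain ⟨j, rfl⟩ : ∃ j, i = k + j := ⟨i - k, by lia⟩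
      rw [mul_add]
      refine (centralTerm_add_two_mul_le hw (by lia) j).trans ?_
      rw [centralTerm_two_mul (by lia)]
      have := Nat.choose_le_succ_of_lt_half_left (show k - w < 2 * k / 2 by lia)
      gcongr
    · obtain ⟨j, rfl⟩ : ∃ j, i = k + j := ⟨i - k, by lia⟩
      rw [show 2 * (k + j) + 1 = 2 * k + 1 + 2 * j by ring]
      refine (centralTerm_add_two_mul_le hw (by lia) j).trans
        ((centralTerm_two_mul_add_one_le hw (by lia)).trans ?_)
      rw [show k + 1 - w = k - w + 1 by lia]
      exact normalized_choose_succ_le (m := 2 * k) (by lia)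
end

section
/- Let f, g : ℕ → ℝ be positive sequences with f(n) → ∞ and f(n) = o(g(n)), and set h(n) = ⌈n·(1 − f(n)/g(n))⌉. Let w : ℕ → ℕ be a sequence of positive integers with w(n) → ∞, w(n) = o(√(h(n))), and g(n)/w(n) = o(f(n)). Define v(n) = ((2w(n)−1)/(n·2^(n−1))) · gbinom(n−1, (n−1)/2 − w(n)) · (h(n)/(2w(n))) · (1 − (1 − 2w(n)/h(n))^(n−h(n)+1)). Then √n · v(n) → √(2/π) as n → ∞. -/
open Filter

lemma pow_mul_Gamma_le {x : ℝ} (hx : 0 < x) (k : ℕ) :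
    x ^ k * Real.Gamma x ≤ Real.Gamma (x + k) := by
  induction k with
  | zero => simp
  | succ k ih =>
    have hk : Real.Gamma (x + (k + 1 : ℕ)) = (x + k) * Real.Gamma (x + k) := by
      rw [← Real.Gamma_add_one (by positivity)]
      push_cast
      ring_nf
    have hpos := Real.Gamma_pos_of_pos hx
    calc x ^ (k + 1) * Real.Gamma x = x * (x ^ k * Real.Gamma x) := by ring
      _ ≤ (x + k) * Real.Gamma (x + k) :=
        mul_le_mul (by simp) ih (by positivity) (by positivity)
      _ = _ := hk.symm

lemma Gamma_add_nat_le {x : ℝ} (hx : 0 < x) (k : ℕ) :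
    Real.Gamma (x + k) ≤ (x + k) ^ k * Real.Gamma x := by
  induction k with
  | zero => simp
  | succ k ih =>
    have hk : Real.Gamma (x + (k + 1 : ℕ)) = (x + k) * Real.Gamma (x + k) := by
      rw [← Real.Gamma_add_one (by positivity)]
      push_cast
      ring_nf
    have hpos := Real.Gamma_pos_of_pos hx
    calc Real.Gamma (x + (k + 1 : ℕ)) ≤ (x + k) * ((x + k) ^ k * Real.Gamma x) := by
          rw [hk]
          gcongr
      _ = (x + k) ^ (k + 1) * Real.Gamma x := by ring
      _ ≤ (x + (k + 1 : ℕ)) ^ (k + 1) * Real.Gamma x := by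
          gcongr
          simp

lemma Gamma_sq_le {a : ℝ} {k : ℕ} (hk : k < a) :
    Real.Gamma a ^ 2 ≤ Real.Gamma (a - k) * Real.Gamma (a + k) := by
  have hx : 0 < a - k := sub_pos.2 hk
  have ha : 0 < a := hk.trans_le' (Nat.cast_nonneg k)
  have h₁ := Gamma_add_nat_le hx k
  have h₂ := pow_mul_Gamma_le ha k
  rw [sub_add_cancel] at h₁
  have hpos := Real.Gamma_pos_of_pos hx
  have hpos' := Real.Gamma_pos_of_pos ha
  calc Real.Gamma a ^ 2 ≤ (a ^ k * Real.Gamma (a - k)) * Real.Gamma a := by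
        rw [sq]
        gcongr
    _ = Real.Gamma (a - k) * (a ^ k * Real.Gamma a) := by ring
    _ ≤ _ := by gcongr

lemma one_sub_mul_Gamma_le_Gamma_sq {a : ℝ} {k : ℕ} (hk : k < a) :
    (1 - 2 * k ^ 2 / a) * (Real.Gamma (a - k) * Real.Gamma (a + k)) ≤ Real.Gamma a ^ 2 := by
  have hx : 0 < a - k := sub_pos.2 hk
  have hk0 : (0 : ℝ) ≤ k := Nat.cast_nonneg k
  have ha : 0 < a := hk.trans_le' hk0
  have hak : 0 < a + k := by positivity
  have h₁ := pow_mul_Gamma_le hx k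
  have h₂ := Gamma_add_nat_le ha k
  rw [sub_add_cancel] at h₁
  have hpos := Real.Gamma_pos_of_pos hx
  have hpos' := Real.Gamma_pos_of_pos ha
  have hpos'' := Real.Gamma_pos_of_pos hak
  have hratio : (a - k) / (a + k) = 1 + -(2 * k / (a + k)) := by
    field_simp
    ring
  have hle : 2 * (k : ℝ) / (a + k) ≤ 2 * k / a := by
    gcongr
    linarith
  have hle2 : 2 * (k : ℝ) / (a + k) ≤ 2 := by
    rw [div_le_iff₀ hak]
    linarith
  have hbern : 1 - 2 * k ^ 2 / a ≤ ((a - k) / (a + k)) ^ k := by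
    rw [hratio]
    refine le_trans ?_ (one_add_mul_le_pow (by linarith) k)
    have := mul_le_mul_of_nonneg_left hle hk0
    have e : (k : ℝ) * (2 * k / a) = 2 * k ^ 2 / a := by ring
    linarith
  calc (1 - 2 * k ^ 2 / a) * (Real.Gamma (a - k) * Real.Gamma (a + k))
      ≤ ((a - k) / (a + k)) ^ k * (Real.Gamma (a - k) * Real.Gamma (a + k)) := by gcongr
    _ ≤ ((a - k) / (a + k)) ^ k * (Real.Gamma (a - k) * ((a + k) ^ k * Real.Gamma a)) := by
        gcongr
    _ = ((a - k) ^ k * Real.Gamma (a - k)) * Real.Gamma a := by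
        rw [div_pow]
        field_simp
    _ ≤ Real.Gamma a * Real.Gamma a := by gcongr
    _ = _ := (sq _).symm

lemma Gamma_sq_le_Gamma_mul_Gamma {x : ℝ} (hx : 0 < x) :
    Real.Gamma (x + 1 / 2) ^ 2 ≤ Real.Gamma x * Real.Gamma (x + 1) := by
  have h := Real.Gamma_mul_add_mul_le_rpow_Gamma_mul_rpow_Gamma hx (by positivity : 0 < x + 1)
    (by norm_num : (0 : ℝ) < 1 / 2) (by norm_num : (0 : ℝ) < 1 / 2) (by norm_num)
  have h0 := (Real.Gamma_pos_of_pos hx).le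
  have h1 := (Real.Gamma_pos_of_pos (by positivity : 0 < x + 1)).le
  have e : 1 / 2 * x + 1 / 2 * (x + 1) = x + 1 / 2 := by ring
  rw [e, ← Real.sqrt_eq_rpow, ← Real.sqrt_eq_rpow, ← Real.sqrt_mul h0] at h
  exact (Real.le_sqrt' (Real.Gamma_pos_of_pos (by positivity))).1 h

lemma Gamma_add_half_sq_le {x : ℝ} (hx : 0 < x) :
    Real.Gamma (x + 1 / 2) ^ 2 ≤ x * Real.Gamma x ^ 2 := by
  refine (Gamma_sq_le_Gamma_mul_Gamma hx).trans_eq ?_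
  rw [Real.Gamma_add_one hx.ne']
  ring

lemma le_Gamma_add_half_sq {x : ℝ} (hx : 1 / 2 < x) :
    (x - 1 / 2) * Real.Gamma x ^ 2 ≤ Real.Gamma (x + 1 / 2) ^ 2 := by
  have hy : 0 < x - 1 / 2 := by linarith
  have h := Gamma_sq_le_Gamma_mul_Gamma hy
  rw [sub_add_cancel, show x - 1 / 2 + 1 = x + 1 / 2 by ring] at h
  have e : Real.Gamma (x + 1 / 2) = (x - 1 / 2) * Real.Gamma (x - 1 / 2) := by
    rw [← Real.Gamma_add_one hy.ne']
    ring_nf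
  calc (x - 1 / 2) * Real.Gamma x ^ 2
      ≤ (x - 1 / 2) * (Real.Gamma (x - 1 / 2) * Real.Gamma (x + 1 / 2)) := by gcongr
    _ = Real.Gamma (x + 1 / 2) ^ 2 := by rw [sq, ← mul_assoc, ← e]

lemma tendsto_sqrt_mul_Gamma_div :
    Tendsto (fun x : ℝ => √x * (Real.Gamma x / Real.Gamma (x + 1 / 2))) atTop (nhds 1) := by
  have hlim : Tendsto (fun x : ℝ => √(1 + (1 / 2) / (x - 1 / 2))) atTop (nhds 1) := by
    have h : Tendsto (fun x : ℝ => (1 / 2) / (x - 1 / 2)) atTop (nhds 0) :=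
      (tendsto_atTop_add_const_right atTop (-(1 / 2) : ℝ) tendsto_id).const_div_atTop _
    simpa using (h.const_add 1).sqrt
  refine tendsto_of_tendsto_of_tendsto_of_le_of_le' tendsto_const_nhds hlim ?_ ?_
  · filter_upwards [eventually_gt_atTop 0] with x hx
    have hG := Real.Gamma_pos_of_pos hx
    have hG' := Real.Gamma_pos_of_pos (by positivity : 0 < x + 1 / 2)
    rw [← mul_div_assoc, one_le_div hG']
    apply le_of_sq_le_sq _ (by positivity)
    rw [mul_pow, Real.sq_sqrt hx.le]
    exact Gamma_add_half_sq_le hx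
  · filter_upwards [eventually_gt_atTop (1 / 2)] with x hx
    have hx0 : 0 < x := by linarith
    have hy : 0 < x - 1 / 2 := by linarith
    have hG' := Real.Gamma_pos_of_pos (by positivity : 0 < x + 1 / 2)
    apply Real.le_sqrt_of_sq_le
    rw [mul_pow, Real.sq_sqrt hx0.le, div_pow, ← mul_div_assoc, div_le_iff₀ (by positivity)]
    have e : 1 + 1 / 2 / (x - 1 / 2) = x / (x - 1 / 2) := by
      rw [eq_div_iff hy.ne', add_mul, div_mul_cancel₀ _ hy.ne']
      ring
    rw [e, div_mul_eq_mul_div, le_div_iff₀ hy]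
    have := mul_le_mul_of_nonneg_left (le_Gamma_add_half_sq hx) hx0.le
    linarith

/-- The shifted central binomial coefficient, through the duplication formula. -/
lemma gbinom_div_two_pow {n : ℕ} (hn : 0 < n) (k : ℕ) :
    gbinom (n - 1) (((n : ℝ) - 1) / 2 - k) / 2 ^ (n - 1) =
      (Real.Gamma (n / 2) / Real.Gamma ((n : ℝ) / 2 + 1 / 2) / √Real.pi) *
        (Real.Gamma ((n : ℝ) / 2 + 1 / 2) ^ 2 /
          (Real.Gamma ((n : ℝ) / 2 + 1 / 2 - k) * Real.Gamma ((n : ℝ) / 2 + 1 / 2 + k))) := by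
  have hdup := Real.Gamma_mul_Gamma_add_half ((n : ℝ) / 2)
  have hcast : ((n - 1 : ℕ) : ℝ) = n - 1 := by
    rw [Nat.cast_sub hn, Nat.cast_one]
  have hpow : (2 : ℝ) ^ (1 - 2 * ((n : ℝ) / 2)) = (2 ^ (n - 1))⁻¹ := by
    rw [← Real.rpow_natCast, ← Real.rpow_neg zero_le_two, hcast]
    ring_nf
  have e0 : 2 * ((n : ℝ) / 2) = n := by ring
  rw [hpow, e0] at hdup
  have hG : Real.Gamma ((n : ℝ) / 2 + 1 / 2) ≠ 0 :=
    (Real.Gamma_pos_of_pos (by positivity)).ne'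
  have hpi : √Real.pi ≠ 0 := (Real.sqrt_pos.2 Real.pi_pos).ne'
  have hmain : Real.Gamma n / 2 ^ (n - 1) =
      Real.Gamma (n / 2) / Real.Gamma ((n : ℝ) / 2 + 1 / 2) / √Real.pi *
        Real.Gamma ((n : ℝ) / 2 + 1 / 2) ^ 2 := by
    field_simp at hdup ⊢
    linarith
  have e1 : (n : ℝ) - 1 + 1 = n := by ring
  have e2 : ((n : ℝ) - 1) / 2 - k + 1 = n / 2 + 1 / 2 - k := by ring
  have e3 : (n : ℝ) - 1 - (((n : ℝ) - 1) / 2 - k) + 1 = n / 2 + 1 / 2 + k := by ring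
  rw [gbinom, hcast, e1, e2, e3, div_right_comm, hmain, mul_div_assoc]

lemma tendsto_sqrt_mul_gbinom {w : ℕ → ℕ}
    (hw : Tendsto (fun n => (w n : ℝ) ^ 2 / n) atTop (nhds 0)) :
    Tendsto (fun n : ℕ => √n * (gbinom (n - 1) (((n : ℝ) - 1) / 2 - w n) / 2 ^ (n - 1)))
      atTop (nhds √(2 / Real.pi)) := by
  have hcentral : Tendsto (fun n : ℕ =>
      √((n : ℝ) / 2) * (Real.Gamma (n / 2) / Real.Gamma ((n : ℝ) / 2 + 1 / 2)))
      atTop (nhds 1) :=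
    tendsto_sqrt_mul_Gamma_div.comp
      (tendsto_natCast_atTop_atTop.atTop_div_const (by norm_num : (0 : ℝ) < 2))
  have hlt : ∀ᶠ n : ℕ in atTop, (w n : ℝ) < (n : ℝ) / 2 + 1 / 2 := by
    filter_upwards [hw.eventually_lt_const (by norm_num : (0 : ℝ) < 1 / 4),
      eventually_gt_atTop 0] with n h hn
    have hn' : (0 : ℝ) < n := Nat.cast_pos.2 hn
    rw [div_lt_iff₀ hn'] at h
    nlinarith [sq_nonneg ((w n : ℝ) - 1 / 4)]
  have hshift : Tendsto (fun n : ℕ => Real.Gamma ((n : ℝ) / 2 + 1 / 2) ^ 2 /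
      (Real.Gamma ((n : ℝ) / 2 + 1 / 2 - w n) * Real.Gamma ((n : ℝ) / 2 + 1 / 2 + w n)))
      atTop (nhds 1) := by
    have hlow : Tendsto (fun n => 1 - 4 * ((w n : ℝ) ^ 2 / n)) atTop (nhds 1) := by
      simpa using (hw.const_mul 4).const_sub 1
    refine tendsto_of_tendsto_of_tendsto_of_le_of_le' hlow tendsto_const_nhds ?_ ?_
    · filter_upwards [hlt, eventually_gt_atTop 0] with n h hn
      have hn' : (0 : ℝ) < n := Nat.cast_pos.2 hn
      have h₁ := Real.Gamma_pos_of_pos (sub_pos.2 h)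
      have h₂ := Real.Gamma_pos_of_pos (by positivity : (0 : ℝ) < n / 2 + 1 / 2 + w n)
      rw [le_div_iff₀ (by positivity)]
      refine le_trans ?_ (one_sub_mul_Gamma_le_Gamma_sq h)
      gcongr
      have e : 4 * ((w n : ℝ) ^ 2 / n) = 2 * (w n : ℝ) ^ 2 / (n / 2) := by
        field_simp
        ring
      rw [e]
      gcongr
      linarith
    · filter_upwards [hlt] with n h
      have h₁ := Real.Gamma_pos_of_pos (sub_pos.2 h)
      have h₂ := Real.Gamma_pos_of_pos (by positivity : (0 : ℝ) < n / 2 + 1 / 2 + w n)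
      rw [div_le_one (by positivity)]
      exact Gamma_sq_le h
  have hprod := (hcentral.mul hshift).const_mul √(2 / Real.pi)
  rw [mul_one, mul_one] at hprod
  refine hprod.congr' ?_
  filter_upwards [eventually_gt_atTop 0] with n hn
  rw [gbinom_div_two_pow hn, Real.sqrt_div zero_le_two, Real.sqrt_div (Nat.cast_nonneg n)]
  have h2 : √(2 : ℝ) ≠ 0 := by positivity
  field_simp

lemma tendsto_one_sub_pow_zero {x : ℕ → ℝ} {m : ℕ → ℕ} (hx : ∀ᶠ n in atTop, x n ≤ 1)
    (hxm : Tendsto (fun n => m n * x n) atTop atTop) :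
    Tendsto (fun n => (1 - x n) ^ m n) atTop (nhds 0) := by
  refine tendsto_of_tendsto_of_tendsto_of_le_of_le' tendsto_const_nhds
    (Real.tendsto_exp_neg_atTop_nhds_zero.comp hxm) ?_ ?_
  · filter_upwards [hx] with n h
    exact pow_nonneg (sub_nonneg.2 h) _
  · filter_upwards [hx] with n h
    calc (1 - x n) ^ m n ≤ Real.exp (-x n) ^ m n :=
          pow_le_pow_left₀ (sub_nonneg.2 h) (Real.one_sub_le_exp_neg _) _
      _ = Real.exp (-(m n * x n)) := by
          rw [← Real.exp_nat_mul]
          ring_nf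

/-- Let `f, g` be positive real sequences with `f(n) → ∞` and `f = o(g)`, let
`h(n) = ⌈n (1 - f(n)/g(n))⌉`, and let `w` be a sequence of positive integers with
`w(n) → ∞`, `w(n) = o(√(h(n)))` and `g(n)/w(n) = o(f(n))`.  Then for
`v(n) = ((2w-1)/(n·2^(n-1))) · gbinom (n-1) ((n-1)/2 - w) · (h/(2w)) · (1-(1-2w/h)^(n-h+1))`
one has `√n · v(n) → √(2/π)`. -/
theorem sqrt_n_v_tendsto (f g : ℕ → ℝ) (hf : ∀ n, 0 < f n) (hg : ∀ n, 0 < g n)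
    (hftop : Tendsto f atTop atTop)
    (hfg : Tendsto (fun n => f n / g n) atTop (nhds 0))
    (h : ℕ → ℕ) (hdef : ∀ n, h n = ⌈(n : ℝ) * (1 - f n / g n)⌉₊)
    (w : ℕ → ℕ) (hw : ∀ n, 0 < w n)
    (hwtop : Tendsto w atTop atTop)
    (hwh : Tendsto (fun n => (w n : ℝ) / Real.sqrt (h n)) atTop (nhds 0))
    (hgwf : Tendsto (fun n => ((g n / w n) / f n)) atTop (nhds 0)) :
    Tendsto (fun n : ℕ => Real.sqrt n *
      ((2 * (w n : ℝ) - 1) / (n * 2 ^ (n - 1)) *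
        gbinom (n - 1) (((n : ℝ) - 1) / 2 - w n) * ((h n : ℝ) / (2 * w n)) *
        (1 - (1 - 2 * (w n : ℝ) / h n) ^ (n - h n + 1))))
      atTop (nhds (Real.sqrt (2 / Real.pi))) := by
  have hw' : ∀ n, (0 : ℝ) < w n := fun n => Nat.cast_pos.2 (hw n)
  have hratio_pos : ∀ n, 0 < f n / g n := fun n => div_pos (hf n) (hg n)
  have hle : ∀ n, h n ≤ n := fun n => by
    rw [hdef, Nat.ceil_le]
    nlinarith [hratio_pos n, Nat.cast_nonneg (α := ℝ) n]
  have hle' : ∀ n, (h n : ℝ) ≤ n := fun n => Nat.cast_le.2 (hle n)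
  have hge : ∀ n : ℕ, (n : ℝ) * (1 - f n / g n) ≤ h n := fun n => by
    rw [hdef]
    exact Nat.le_ceil _
  have hhn : Tendsto (fun n => (h n : ℝ) / n) atTop (nhds 1) := by
    refine tendsto_of_tendsto_of_tendsto_of_le_of_le' (by simpa using hfg.const_sub 1)
      tendsto_const_nhds ?_ (Eventually.of_forall fun n => div_le_one_of_le₀ (hle' n) (by simp))
    filter_upwards [eventually_gt_atTop 0] with n hn
    rw [le_div_iff₀ (Nat.cast_pos.2 hn), mul_comm]
    exact hge n
  have hsmall : ∀ᶠ n in atTop, f n / g n < 1 := hfg.eventually_lt_const zero_lt_one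
  have hpos : ∀ᶠ n in atTop, (0 : ℝ) < h n := by
    filter_upwards [hsmall, eventually_gt_atTop 0] with n h₁ hn
    exact (mul_pos (Nat.cast_pos.2 hn) (sub_pos.2 h₁)).trans_le (hge n)
  have hwh2 : Tendsto (fun n => (w n : ℝ) ^ 2 / h n) atTop (nhds 0) := by
    simpa [div_pow] using hwh.pow 2
  have hwn : Tendsto (fun n => (w n : ℝ) ^ 2 / n) atTop (nhds 0) := by
    refine squeeze_zero' (Eventually.of_forall fun n => by positivity) ?_ hwh2
    filter_upwards [hpos] with n hn
    gcongr
    exact hle n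
  have hx : ∀ᶠ n in atTop, 2 * (w n : ℝ) / h n ≤ 1 := by
    filter_upwards [hpos, hwh2.eventually_lt_const (by norm_num : (0 : ℝ) < 1 / 2)] with n hn h₁
    rw [div_lt_iff₀ hn] at h₁
    rw [div_le_one hn]
    have : (1 : ℝ) ≤ w n := Nat.one_le_cast.2 (hw n)
    nlinarith
  have htop : Tendsto (fun n => w n * (f n / g n)) atTop atTop := by
    have h₁ : Tendsto (fun n => g n / w n / f n) atTop (nhdsWithin 0 (Set.Ioi 0)) :=
      tendsto_nhdsWithin_iff.2 ⟨hgwf, Eventually.of_forall fun n =>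
        div_pos (div_pos (hg n) (hw' n)) (hf n)⟩
    refine h₁.inv_tendsto_nhdsGT_zero.congr fun n => ?_
    have := (hf n).ne'
    have := (hg n).ne'
    have := (hw' n).ne'
    simp only [Pi.inv_apply]
    field_simp
  have hpow : Tendsto (fun n => (1 - 2 * (w n : ℝ) / h n) ^ (n - h n + 1)) atTop (nhds 0) := by
    refine tendsto_one_sub_pow_zero hx (tendsto_atTop_mono' atTop ?_ htop)
    filter_upwards [hpos, hsmall] with n hn h₁
    have hlt : (h n : ℝ) < n * (1 - f n / g n) + 1 := by
      conv_lhs => rw [hdef]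
      exact Nat.ceil_lt_add_one (mul_nonneg (Nat.cast_nonneg n) (sub_nonneg.2 h₁.le))
    push_cast [Nat.cast_sub (hle n)]
    rw [← mul_div_assoc (_ + 1 : ℝ), le_div_iff₀ hn]
    have hr := hratio_pos n
    have hbound : h n * (f n / g n) ≤ n - h n + 1 :=
      (mul_le_mul_of_nonneg_right (hle' n) hr.le).trans (by linarith)
    have := mul_le_mul_of_nonneg_left hbound (hw' n).le
    have : 0 ≤ w n * (h n * (f n / g n)) := by
      have := hw' n
      positivity
    linarith
  have hfirst : Tendsto (fun n => 1 - 1 / (2 * (w n : ℝ))) atTop (nhds 1) := by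
    have h₁ : Tendsto (fun n => 2 * (w n : ℝ)) atTop atTop :=
      (tendsto_natCast_atTop_atTop.comp hwtop).const_mul_atTop zero_lt_two
    simpa using (h₁.const_div_atTop 1).const_sub 1
  have hall := ((hfirst.mul hhn).mul (tendsto_sqrt_mul_gbinom hwn)).mul (hpow.const_sub 1)
  simp only [sub_zero, mul_one, one_mul] at hall
  refine hall.congr fun n => ?_
  have hne := (hw' n).ne'
  have e : 1 - 1 / (2 * (w n : ℝ)) = (2 * w n - 1) / (2 * w n) := by
    field_simp
  rw [e]
  simp only [div_eq_mul_inv, mul_inv]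
  ring
end
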